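/- Let δ ≥ 0 and let H be a proper δ-hyperbolic Busemann space with fixed base point w ∈ H and boundary point a ∈ ∂H. Let V₁ and V₂ be vertical geodesics of H, parametrised so that h(V_i(t)) = t. Then for every pair of times (t₁, t₂) and every t ∈ [0, ½·d_r(V₁(t₁), V₂(t₂))]: | d_r( V₁(t₁ + ½·d_r(V₁(t₁),V₂(t₂)) − t), V₂(t₂ + ½·d_r(V₁(t₁),V₂(t₂)) − t) ) − 2t | ≤ 288δ. -/

import Mathlib

open Set Filter
open scoped ENNReal NNReal

noncomputable section

namespace HP

variable {H : Type*} [MetricSpace H]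

/-- `γ` restricted to `I` is an arclength-parametrised (isometric) geodesic. -/
def IsGeodesicOn (γ : ℝ → H) (I : Set ℝ) : Prop :=
  ∀ s ∈ I, ∀ t ∈ I, dist (γ s) (γ t) = |s - t|

/-- A geodesic line of `H`. -/
def IsGeodesicLine (γ : ℝ → H) : Prop := IsGeodesicOn γ Set.univ

/-- A geodesic ray of `H`, parametrised on `[0,∞)`. -/
def IsGeodesicRay (γ : ℝ → H) : Prop := IsGeodesicOn γ (Set.Ici 0)

/-- A geodesic ray starting at `w`. -/
def IsRayFrom (w : H) (γ : ℝ → H) : Prop := IsGeodesicRay γ ∧ γ 0 = w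

/-- A geodesic segment from `x` to `y`, parametrised on `[0, dist x y]`. -/
def IsGeodSegment (γ : ℝ → H) (x y : H) : Prop :=
  IsGeodesicOn γ (Set.Icc 0 (dist x y)) ∧ γ 0 = x ∧ γ (dist x y) = y

/-- The traces on `[0,∞)` of two rays are at finite Hausdorff distance. -/
def FinHausRays (γ₁ γ₂ : ℝ → H) : Prop :=
  ∃ C : ℝ, (∀ s : ℝ, 0 ≤ s → ∃ t : ℝ, 0 ≤ t ∧ dist (γ₁ s) (γ₂ t) ≤ C) ∧
           (∀ t : ℝ, 0 ≤ t → ∃ s : ℝ, 0 ≤ s ∧ dist (γ₁ s) (γ₂ t) ≤ C)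

/-- A geodesic metric space: any two points are joined by a geodesic segment. -/
def GeodesicSpace (H : Type*) [MetricSpace H] : Prop :=
  ∀ x y : H, ∃ γ : ℝ → H, IsGeodSegment γ x y

/-- `δ`-hyperbolicity: geodesic space all of whose geodesic triangles are `δ`-slim,
i.e. each side is contained in the `δ`-neighbourhood of the union of the other two. -/
def DeltaHyperbolic (H : Type*) [MetricSpace H] (δ : ℝ) : Prop :=
  GeodesicSpace H ∧
  ∀ x y z : H, ∀ γ₁ γ₂ γ₃ : ℝ → H,
    IsGeodSegment γ₁ x y → IsGeodSegment γ₂ y z → IsGeodSegment γ₃ z x →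
    ∀ s ∈ Set.Icc (0:ℝ) (dist x y),
      ∃ u ∈ γ₂ '' Set.Icc (0:ℝ) (dist y z) ∪ γ₃ '' Set.Icc (0:ℝ) (dist z x),
        dist (γ₁ s) u ≤ δ

/-- A Busemann space: geodesic, and the distance between any two
arclength-parametrised geodesics is a convex function. -/
def BusemannSpace (H : Type*) [MetricSpace H] : Prop :=
  GeodesicSpace H ∧
  ∀ (a b a' b' : ℝ) (γ γ' : ℝ → H),
    IsGeodesicOn γ (Set.Icc a b) → IsGeodesicOn γ' (Set.Icc a' b') →
    ConvexOn ℝ (Set.Icc a b ×ˢ Set.Icc a' b')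
      (fun p : ℝ × ℝ => dist (γ p.1) (γ' p.2))

/-- Geodesic completeness: every geodesic segment extends to a geodesic line. -/
def GeodesicallyComplete (H : Type*) [MetricSpace H] : Prop :=
  ∀ (a b : ℝ) (γ : ℝ → H), a ≤ b → IsGeodesicOn γ (Set.Icc a b) →
    ∃ γ' : ℝ → H, IsGeodesicLine γ' ∧ ∀ t ∈ Set.Icc a b, γ' t = γ t

/-- The Busemann function with respect to the boundary point represented by the
geodesic ray `aRep` and the base point `w`. -/
def busemann (w : H) (aRep : ℝ → H) (x : H) : ℝ :=
  sSup { b : ℝ | ∃ k : ℝ → H, IsRayFrom w k ∧ FinHausRays aRep k ∧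
    b = Filter.limsup (fun t => dist x (k t) - t) Filter.atTop }

/-- The height function: minus the Busemann function. -/
def height (w : H) (aRep : ℝ → H) (x : H) : ℝ := - busemann w aRep x

/-- A vertical geodesic (forward oriented): a geodesic line whose height tends to `+∞`. -/
def IsVerticalGeodesic (w : H) (aRep : ℝ → H) (V : ℝ → H) : Prop :=
  IsGeodesicLine V ∧ Tendsto (fun t => height w aRep (V t)) atTop atTop

/-- A vertical geodesic line (either orientation): a geodesic line whose image lies
in the boundary class, i.e. whose height tends to `+∞` along one of its ends. -/
def IsVerticalGeodesicLine (w : H) (aRep : ℝ → H) (V : ℝ → H) : Prop :=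
  IsGeodesicLine V ∧
    (Tendsto (fun t => height w aRep (V t)) atTop atTop ∨
     Tendsto (fun t => height w aRep (V t)) atBot atTop)

/-- A vertical geodesic parametrised by its height: `h(V(t)) = t` for all `t`. -/
def VertParam (w : H) (aRep : ℝ → H) (V : ℝ → H) : Prop :=
  IsGeodesicLine V ∧ ∀ t : ℝ, height w aRep (V t) = t

/-- Height difference `Δh(x,y)`. -/
def dh (w : H) (aRep : ℝ → H) (x y : H) : ℝ :=
  |height w aRep x - height w aRep y|

/-- Relative distance `d_r(x,y) = d(x,y) - Δh(x,y)`. -/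
def dr (w : H) (aRep : ℝ → H) (x y : H) : ℝ := dist x y - dh w aRep x y

/-- Maximal height `h⁺` of a path along the parameter set `I`. -/
def hplusOn (w : H) (aRep : ℝ → H) (γ : ℝ → H) (I : Set ℝ) : ℝ :=
  sSup ((fun t => height w aRep (γ t)) '' I)

/-- Minimal height `h⁻` of a path along the parameter set `I`. -/
def hminusOn (w : H) (aRep : ℝ → H) (γ : ℝ → H) (I : Set ℝ) : ℝ :=
  sInf ((fun t => height w aRep (γ t)) '' I)

/-- A path parametrised by arclength: the length of the piece on `[s,t]` equals `t - s`. -/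
def ArclengthPath (V : ℝ → H) : Prop :=
  ∀ s t : ℝ, s ≤ t → eVariationOn V (Set.Icc s t) = ENNReal.ofReal (t - s)

/-- An admissible norm on `ℝ²`: a norm with `N(1,1) = 1` and `N(a,b) ≥ (a+b)/2`. -/
structure AdmNorm where
  toFun : ℝ × ℝ → ℝ
  eq_zero_iff : ∀ v : ℝ × ℝ, toFun v = 0 ↔ v = 0
  smul_eq : ∀ (c : ℝ) (v : ℝ × ℝ), toFun (c • v) = |c| * toFun v
  add_le : ∀ v w : ℝ × ℝ, toFun (v + w) ≤ toFun v + toFun w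
  one_one : toFun (1, 1) = 1
  adm : ∀ a b : ℝ, (a + b) / 2 ≤ toFun (a, b)

/-- `C` is a comparison constant `C_N` for the admissible norm `N`:
`C ≥ 1` and `N(a,b) ≤ C(a+b)/2` for all `a,b ≥ 0`. -/
def AdmNorm.BoundConst (N : AdmNorm) (C : ℝ) : Prop :=
  1 ≤ C ∧ ∀ a b : ℝ, 0 ≤ a → 0 ≤ b → N.toFun (a, b) ≤ C * (a + b) / 2

variable {Hp Hq : Type*} [MetricSpace Hp] [MetricSpace Hq]

/-- Membership in the horospherical product: `h_p(x_p) + h_q(x_q) = 0`. -/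
def inHoro (wp : Hp) (ap : ℝ → Hp) (wq : Hq) (aq : ℝ → Hq) (z : Hp × Hq) : Prop :=
  height wp ap z.1 + height wq aq z.2 = 0

/-- The `N`-length of a path in `Hp × Hq`: supremum over finite monotone
subdivisions of the sums of the `N(d_p, d_q)`-distances. -/
def lN (Nf : ℝ × ℝ → ℝ) (γ : ℝ → Hp × Hq) (s : Set ℝ) : ℝ≥0∞ :=
  ⨆ p : ℕ × { u : ℕ → ℝ // Monotone u ∧ ∀ i, u i ∈ s },
    ∑ i ∈ Finset.range p.1,
      ENNReal.ofReal (Nf (dist (γ (p.2.1 (i+1))).1 (γ (p.2.1 i)).1,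
                          dist (γ (p.2.1 (i+1))).2 (γ (p.2.1 i)).2))

/-- The `N`-path metric: infimum of `N`-lengths of connected paths staying in the
horospherical product and joining the two points. -/
def dHN (Nf : ℝ × ℝ → ℝ) (mem : Hp × Hq → Prop) (x y : Hp × Hq) : ℝ≥0∞ :=
  ⨅ (T : ℝ) (_ : 0 ≤ T) (γ : ℝ → Hp × Hq) (_ : ContinuousOn γ (Set.Icc 0 T))
    (_ : ∀ t ∈ Set.Icc (0:ℝ) T, mem (γ t)) (_ : γ 0 = x) (_ : γ T = y),
    lN Nf γ (Set.Icc 0 T)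

/-- A geodesic of the horospherical product with respect to the `N`-path metric,
parametrised (by arclength) on `I` and staying in the product. -/
def IsHNGeodesicOn (Nf : ℝ × ℝ → ℝ) (mem : Hp × Hq → Prop)
    (α : ℝ → Hp × Hq) (I : Set ℝ) : Prop :=
  (∀ t ∈ I, mem (α t)) ∧
  ∀ s ∈ I, ∀ t ∈ I, dHN Nf mem (α s) (α t) = ENNReal.ofReal |s - t|

/-- A vertical geodesic of the horospherical product, parametrised by its height. -/
def IsHNVerticalLine (Nf : ℝ × ℝ → ℝ) (mem : Hp × Hq → Prop)
    (wp : Hp) (ap : ℝ → Hp) (V : ℝ → Hp × Hq) : Prop :=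
  IsHNGeodesicOn Nf mem V Set.univ ∧ ∀ t : ℝ, height wp ap (V t).1 = t

/-- Maximal height `h⁺` of a path of the horospherical product. -/
def hplusH (wp : Hp) (ap : ℝ → Hp) (γ : ℝ → Hp × Hq) (I : Set ℝ) : ℝ :=
  sSup ((fun t => height wp ap (γ t).1) '' I)

/-- Minimal height `h⁻` of a path of the horospherical product. -/
def hminusH (wp : Hp) (ap : ℝ → Hp) (γ : ℝ → Hp × Hq) (I : Set ℝ) : ℝ :=
  sInf ((fun t => height wp ap (γ t).1) '' I)

/-- `H_p`-type path at scale `κ`: the first component stays `κ`-close to a geodesic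
of `H_p` and the second component stays `κ`-close to a vertical geodesic of `H_q`. -/
def IsHpType (wq : Hq) (aq : ℝ → Hq) (κ : ℝ) (α : ℝ → Hp × Hq) : Prop :=
  (∃ g : ℝ → Hp, IsGeodesicLine g ∧ ∀ t : ℝ, ∃ s : ℝ, dist (α t).1 (g s) ≤ κ) ∧
  (∃ v : ℝ → Hq, IsVerticalGeodesicLine wq aq v ∧ ∀ t : ℝ, ∃ s : ℝ, dist (α t).2 (v s) ≤ κ)

/-- `H_q`-type path at scale `κ`. -/
def IsHqType (wp : Hp) (ap : ℝ → Hp) (κ : ℝ) (α : ℝ → Hp × Hq) : Prop :=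
  (∃ g : ℝ → Hq, IsGeodesicLine g ∧ ∀ t : ℝ, ∃ s : ℝ, dist (α t).2 (g s) ≤ κ) ∧
  (∃ v : ℝ → Hp, IsVerticalGeodesicLine wp ap v ∧ ∀ t : ℝ, ∃ s : ℝ, dist (α t).1 (v s) ≤ κ)

/-- Finite Hausdorff distance on `[0,∞)` between two rays, for a generalized
(`ℝ≥0∞`-valued) distance `dd`. -/
def HNFinHaus {X : Type*} (dd : X → X → ℝ≥0∞) (α β : ℝ → X) : Prop :=
  ∃ C : ℝ, (∀ s : ℝ, 0 ≤ s → ∃ t : ℝ, 0 ≤ t ∧ dd (α s) (β t) ≤ ENNReal.ofReal C) ∧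
           (∀ t : ℝ, 0 ≤ t → ∃ s : ℝ, 0 ≤ s ∧ dd (α s) (β t) ≤ ENNReal.ofReal C)

theorem finHaus_equivalence (H : Type*) [MetricSpace H] :
    Equivalence (fun γ₁ γ₂ : {γ : ℝ → H // IsGeodesicRay γ} => FinHausRays γ₁.1 γ₂.1) := by
  constructor
  · intro γ
    exact ⟨0, fun s hs => ⟨s, hs, by simp⟩, fun t ht => ⟨t, ht, by simp⟩⟩
  · rintro γ₁ γ₂ ⟨C, h1, h2⟩
    refine ⟨C, fun s hs => ?_, fun t ht => ?_⟩
    · obtain ⟨u, hu, hd⟩ := h2 s hs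
      exact ⟨u, hu, by rwa [dist_comm]⟩
    · obtain ⟨u, hu, hd⟩ := h1 t ht
      exact ⟨u, hu, by rwa [dist_comm]⟩
  · rintro γ₁ γ₂ γ₃ ⟨C, h1, h2⟩ ⟨D, g1, g2⟩
    refine ⟨C + D, fun s hs => ?_, fun t ht => ?_⟩
    · obtain ⟨u, hu, hd⟩ := h1 s hs
      obtain ⟨v, hv, he⟩ := g1 u hu
      exact ⟨v, hv, (dist_triangle _ (γ₂.1 u) _).trans (add_le_add hd he)⟩
    · obtain ⟨u, hu, hd⟩ := g2 t ht
      obtain ⟨v, hv, he⟩ := h2 u hu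
      exact ⟨v, hv, (dist_triangle _ (γ₂.1 u) _).trans (add_le_add he hd)⟩

/-- The setoid of geodesic rays up to finite Hausdorff distance. -/
instance raySetoid (H : Type*) [MetricSpace H] : Setoid {γ : ℝ → H // IsGeodesicRay γ} :=
  ⟨fun γ₁ γ₂ => FinHausRays γ₁.1 γ₂.1, finHaus_equivalence H⟩

/-- The Gromov boundary: equivalence classes of geodesic rays at finite
Hausdorff distance. -/
abbrev Bdry (H : Type*) [MetricSpace H] := Quotient (raySetoid H)

/-- The boundary point determined by a geodesic ray. -/
def bdryPt {H : Type*} [MetricSpace H] (γ : ℝ → H) (h : IsGeodesicRay γ) : Bdry H :=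
  Quotient.mk (raySetoid H) ⟨γ, h⟩

/-- The set `((∂H_p ∖ {a_p}) × {a_q}) ∪ ({a_p} × (∂H_q ∖ {a_q}))`. -/
def bdryTarget {Hp Hq : Type*} [MetricSpace Hp] [MetricSpace Hq]
    (ap : ℝ → Hp) (hap : IsGeodesicRay ap)
    (aq : ℝ → Hq) (haq : IsGeodesicRay aq) : Set (Bdry Hp × Bdry Hq) :=
  ((({bdryPt ap hap} : Set (Bdry Hp))ᶜ ×ˢ ({bdryPt aq haq} : Set (Bdry Hq))) ∪
   (({bdryPt ap hap} : Set (Bdry Hp)) ×ˢ ({bdryPt aq haq} : Set (Bdry Hq))ᶜ))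

/-- A point of a geodesic segment splits the distance of its endpoints. -/
theorem IsGeodSegment.dist_eq {γ : ℝ → H} {x y : H} (hγ : IsGeodSegment γ x y) {s : ℝ}
    (hs : s ∈ Set.Icc 0 (dist x y)) :
    dist x (γ s) = s ∧ dist (γ s) y = dist x y - s := by
  obtain ⟨hg, h0, h1⟩ := hγ
  have e0 := hg 0 ⟨le_rfl, dist_nonneg⟩ s hs
  have e1 := hg s hs (dist x y) ⟨dist_nonneg, le_rfl⟩
  rw [h0, zero_sub, abs_neg, abs_of_nonneg hs.1] at e0
  rw [h1, abs_sub_comm, abs_of_nonneg (sub_nonneg.2 hs.2)] at e1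
  exact ⟨e0, e1⟩

/-- Slimness of triangles, in terms of distances only. -/
theorem DeltaHyperbolic.exists_near {δ : ℝ} (hH : DeltaHyperbolic H δ) {x y : H} {γ : ℝ → H}
    (hγ : IsGeodSegment γ x y) (z : H) {s : ℝ} (hs : s ∈ Set.Icc 0 (dist x y)) :
    ∃ u, dist (γ s) u ≤ δ ∧
      (dist x u + dist u z = dist x z ∨ dist y u + dist u z = dist y z) := by
  obtain ⟨γ₂, h₂⟩ := hH.1 y z
  obtain ⟨γ₃, h₃⟩ := hH.1 z x
  obtain ⟨u, hu | hu, hd⟩ := hH.2 x y z γ γ₂ γ₃ hγ h₂ h₃ s hs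
  · obtain ⟨v, hv, rfl⟩ := hu
    obtain ⟨e0, e1⟩ := h₂.dist_eq hv
    exact ⟨_, hd, Or.inr (by linarith)⟩
  · obtain ⟨v, hv, rfl⟩ := hu
    obtain ⟨e0, e1⟩ := h₃.dist_eq hv
    refine ⟨_, hd, Or.inl ?_⟩
    rw [dist_comm x, dist_comm _ z, dist_comm x z]
    linarith

/-- The four point inequality in a space with slim triangles. -/
theorem DeltaHyperbolic.four_point {δ : ℝ} (hH : DeltaHyperbolic H δ) (p q r t : H) :
    dist p q + dist r t ≤ max (dist p r + dist q t) (dist p t + dist q r) + 6 * δ := by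
  obtain ⟨γ, hγ⟩ := hH.1 p q
  have hs : (dist p q + dist p r - dist q r) / 2 ∈ Set.Icc 0 (dist p q) :=
    ⟨by linarith [dist_triangle q p r, dist_comm p q],
      by linarith [dist_triangle p q r]⟩
  obtain ⟨e0, e1⟩ := hγ.dist_eq hs
  obtain ⟨u, hu, hur⟩ := hH.exists_near hγ r hs
  obtain ⟨v, hv, hvt⟩ := hH.exists_near hγ t hs
  set m := γ ((dist p q + dist p r - dist q r) / 2)
  have hmr : dist m r ≤ (dist p r + dist q r - dist p q) / 2 + 2 * δ := by
    have h1 := dist_triangle m u r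
    rcases hur with h | h
    · have h2 := dist_triangle p u m
      rw [dist_comm u m] at h2
      linarith
    · have h2 := dist_triangle q u m
      rw [dist_comm u m, dist_comm q m] at h2
      linarith
  have h1 := dist_triangle v m r
  rw [dist_comm v m] at h1
  have h2 := dist_triangle r v t
  rw [dist_comm r v] at h2
  rcases hvt with h | h
  · have h3 := dist_triangle p v r
    have h4 := le_max_right (dist p r + dist q t) (dist p t + dist q r)
    linarith
  · have h3 := dist_triangle q v r
    have h4 := le_max_left (dist p r + dist q t) (dist p t + dist q r)
    linarith

/-- In a Busemann space, asymptotic rays with the same origin coincide. -/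
theorem BusemannSpace.ray_unique (hB : BusemannSpace H) {w : H} {a k : ℝ → H}
    (ha : IsRayFrom w a) (hk : IsRayFrom w k) (hak : FinHausRays a k) {s : ℝ} (hs : 0 ≤ s) :
    k s = a s := by
  obtain ⟨C, hC, -⟩ := hak
  have hbd : ∀ T, 0 ≤ T → dist (a T) (k T) ≤ 2 * C := by
    intro T hT
    obtain ⟨t, ht, hd⟩ := hC T hT
    have e1 := ha.1 0 (Set.mem_Ici.2 le_rfl) T hT
    have e2 := hk.1 0 (Set.mem_Ici.2 le_rfl) t ht
    have e3 := hk.1 t ht T hT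
    rw [ha.2, zero_sub, abs_neg, abs_of_nonneg hT] at e1
    rw [hk.2, zero_sub, abs_neg, abs_of_nonneg ht] at e2
    have h3 : |t - T| ≤ C := by
      rw [abs_le]
      constructor
      · linarith [dist_triangle w (k t) (a T), dist_comm (k t) (a T)]
      · linarith [dist_triangle w (a T) (k t)]
    linarith [dist_triangle (a T) (k t) (k T)]
  have hconv : ∀ T, s ≤ T → 0 < T → T * dist (a s) (k s) ≤ s * (2 * C) := by
    intro T hsT hT
    have hsub : Set.Icc 0 T ⊆ Set.Ici (0 : ℝ) := fun x hx => hx.1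
    have hc := hB.2 0 T 0 T a k (fun x hx y hy => ha.1 x (hsub hx) y (hsub hy))
      (fun x hx y hy => hk.1 x (hsub hx) y (hsub hy))
    have m0 : (0 : ℝ) ∈ Set.Icc 0 T := ⟨le_rfl, hT.le⟩
    have m1 : T ∈ Set.Icc 0 T := ⟨hT.le, le_rfl⟩
    have h := hc.2 (Set.mk_mem_prod m0 m0) (Set.mk_mem_prod m1 m1)
      (sub_nonneg.2 ((div_le_one hT).2 hsT)) (div_nonneg hs hT.le) (sub_add_cancel 1 (s / T))
    have e : s / T * T = s := div_mul_cancel₀ s hT.ne'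
    simp only [Prod.smul_mk, Prod.mk_add_mk, smul_eq_mul, mul_zero, zero_add, e, ha.2, hk.2,
      dist_self] at h
    calc T * dist (a s) (k s) ≤ T * (s / T * dist (a T) (k T)) := by gcongr
      _ = s * dist (a T) (k T) := by field_simp
      _ ≤ s * (2 * C) := by gcongr; exact hbd T hT.le
  by_contra hne
  have hpos : 0 < dist (a s) (k s) := dist_pos.2 (Ne.symm hne)
  have hC0 : 0 ≤ 2 * C := dist_nonneg.trans (hbd s hs)
  have hq : 0 ≤ s * (2 * C) / dist (a s) (k s) := by positivity
  have h := hconv (s + s * (2 * C) / dist (a s) (k s) + 1) (by linarith) (by linarith)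
  have e : s * (2 * C) / dist (a s) (k s) * dist (a s) (k s) = s * (2 * C) :=
    div_mul_cancel₀ _ hpos.ne'
  nlinarith [mul_nonneg hs hpos.le]

/-- In a Busemann space, the height is the limit defining the Busemann function along any ray
in the class that starts at the base point. -/
theorem BusemannSpace.tendsto_height (hB : BusemannSpace H) {w : H} {a : ℝ → H}
    (ha : IsRayFrom w a) (x : H) :
    Tendsto (fun t => dist x (a t) - t) atTop (nhds (-height w a x)) := by
  have hanti : AntitoneOn (fun t => dist x (a t) - t) (Set.Ici 0) := by
    intro s hs t ht hst
    have e := ha.1 s hs t ht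
    rw [abs_sub_comm, abs_of_nonneg (sub_nonneg.2 hst)] at e
    have := dist_triangle x (a s) (a t)
    simp only
    linarith
  have hanti' : Antitone (fun t => dist x (a (max t 0)) - max t 0) := fun s t hst =>
    hanti (Set.mem_Ici.2 (le_max_right _ _)) (Set.mem_Ici.2 (le_max_right _ _))
      (max_le_max_right 0 hst)
  have hbdd : BddBelow (Set.range (fun t => dist x (a (max t 0)) - max t 0)) := by
    refine ⟨-dist x w, ?_⟩
    rintro _ ⟨t, rfl⟩
    have e := ha.1 0 (Set.mem_Ici.2 le_rfl) (max t 0) (Set.mem_Ici.2 (le_max_right _ _))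
    rw [ha.2, zero_sub, abs_neg, abs_of_nonneg (le_max_right _ _)] at e
    have := dist_triangle w x (a (max t 0))
    rw [dist_comm w x] at this
    simp only
    linarith
  have hlim := (tendsto_atTop_ciInf hanti' hbdd).congr' (f₂ := fun t => dist x (a t) - t) <| by
    filter_upwards [eventually_ge_atTop (0 : ℝ)] with t ht
    rw [max_eq_left ht]
  have hset : { b : ℝ | ∃ k : ℝ → H, IsRayFrom w k ∧ FinHausRays a k ∧
      b = Filter.limsup (fun t => dist x (k t) - t) Filter.atTop } =
      {Filter.limsup (fun t => dist x (a t) - t) Filter.atTop} := by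
    ext b
    constructor
    · rintro ⟨k, hk, hak, rfl⟩
      refine limsup_congr ?_
      filter_upwards [eventually_ge_atTop (0 : ℝ)] with t ht
      rw [hB.ray_unique ha hk hak ht]
    · rintro rfl
      exact ⟨a, ha, (finHaus_equivalence H).refl ⟨a, ha.1⟩, rfl⟩
  rw [height, neg_neg, busemann, hset, csSup_singleton, hlim.limsup_eq]
  exact hlim

/-- The four point inequality with one point sent to the boundary. -/
theorem four_point_height {δ : ℝ} (hH : DeltaHyperbolic H δ) (hB : BusemannSpace H)
    {w : H} {a : ℝ → H} (ha : IsRayFrom w a) (p q r : H) :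
    dist p q - height w a r ≤
      max (dist p r - height w a q) (dist q r - height w a p) + 6 * δ := by
  have hp := hB.tendsto_height ha p
  have hq := hB.tendsto_height ha q
  have hr := hB.tendsto_height ha r
  have h := le_of_tendsto_of_tendsto' (hr.const_add (dist p q))
    (((hq.const_add (dist p r)).max (hp.const_add (dist q r))).add_const (6 * δ)) ?_
  · simpa only [← sub_eq_add_neg] using h
  · intro s
    have h4 := hH.four_point p q r (a s)
    rcases max_cases (dist p r + dist q (a s)) (dist p (a s) + dist q r) with h | h
    · have := le_max_left (dist p r + (dist q (a s) - s)) (dist q r + (dist p (a s) - s))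
      linarith
    · have := le_max_right (dist p r + (dist q (a s) - s)) (dist q r + (dist p (a s) - s))
      linarith

/-- Backwards control of the relative distance along two vertical
geodesics. -/
theorem statement6 {H : Type*} [MetricSpace H] [ProperSpace H]
    (δ : ℝ) (hδ : 0 ≤ δ) (hH : DeltaHyperbolic H δ) (hB : BusemannSpace H)
    (w : H) (a : ℝ → H) (ha : IsRayFrom w a)
    (V₁ V₂ : ℝ → H) (hV₁ : VertParam w a V₁) (hV₂ : VertParam w a V₂)
    (t₁ t₂ t : ℝ) (ht : t ∈ Set.Icc 0 (dr w a (V₁ t₁) (V₂ t₂) / 2)) :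
    |dr w a (V₁ (t₁ + dr w a (V₁ t₁) (V₂ t₂) / 2 - t))
            (V₂ (t₂ + dr w a (V₁ t₁) (V₂ t₂) / 2 - t)) - 2 * t| ≤ 288 * δ := by
  obtain ⟨ht0, ht1⟩ := ht
  obtain ⟨u, hu⟩ : ∃ u, u = dr w a (V₁ t₁) (V₂ t₂) / 2 - t := ⟨_, rfl⟩
  have e₁ : t₁ + dr w a (V₁ t₁) (V₂ t₂) / 2 - t = t₁ + u := by rw [hu]; ring
  have e₂ : t₂ + dr w a (V₁ t₁) (V₂ t₂) / 2 - t = t₂ + u := by rw [hu]; ring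
  have hu0 : 0 ≤ u := by linarith
  have ht : 2 * t = dr w a (V₁ t₁) (V₂ t₂) - 2 * u := by linarith
  have ht' : 0 ≤ dr w a (V₁ t₁) (V₂ t₂) - 2 * u := by linarith
  rw [e₁, e₂, ht]
  have d₁ : dist (V₁ t₁) (V₁ (t₁ + u)) = u := by
    rw [hV₁.1 _ trivial _ trivial, sub_add_cancel_left, abs_neg, abs_of_nonneg hu0]
  have d₂ : dist (V₂ t₂) (V₂ (t₂ + u)) = u := by
    rw [hV₂.1 _ trivial _ trivial, sub_add_cancel_left, abs_neg, abs_of_nonneg hu0]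
  simp only [dr, dh, hV₁.2, hV₂.2, add_sub_add_right_eq_sub] at ht' ⊢
  have hlow : dist (V₁ t₁) (V₂ t₂) - 2 * u ≤ dist (V₁ (t₁ + u)) (V₂ (t₂ + u)) := by
    have h1 := dist_triangle4 (V₁ t₁) (V₁ (t₁ + u)) (V₂ (t₂ + u)) (V₂ t₂)
    rw [dist_comm (V₂ (t₂ + u)) (V₂ t₂)] at h1
    linarith
  have hmid := four_point_height hH hB ha (V₁ t₁) (V₂ (t₂ + u)) (V₂ t₂)
  have htop := four_point_height hH hB ha (V₁ (t₁ + u)) (V₂ (t₂ + u)) (V₁ t₁)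
  rw [hV₁.2, hV₂.2, hV₂.2, dist_comm (V₂ (t₂ + u)) (V₂ t₂), d₂] at hmid
  rw [hV₁.2, hV₁.2, hV₂.2, dist_comm (V₁ (t₁ + u)) (V₁ t₁), d₁,
    dist_comm (V₂ (t₂ + u)) (V₁ t₁)] at htop
  have hab := le_abs_self (t₁ - t₂)
  have hab' := neg_le_abs (t₁ - t₂)
  have hmid' : dist (V₁ t₁) (V₂ (t₂ + u)) ≤ dist (V₁ t₁) (V₂ t₂) - u + 6 * δ := by
    rcases max_cases (dist (V₁ t₁) (V₂ t₂) - (t₂ + u)) (u - t₁) with h | h <;> linarith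
  have htop' : dist (V₁ (t₁ + u)) (V₂ (t₂ + u)) ≤ dist (V₁ t₁) (V₂ t₂) - 2 * u + 12 * δ := by
    rcases max_cases (u - (t₂ + u)) (dist (V₁ t₁) (V₂ (t₂ + u)) - (t₁ + u)) with h | h <;>
      linarith
  rw [abs_le]
  constructor <;> linarith

end HP

end
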